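/- (Corollary 1) Let d ≥ 2 and n = d+1. For any symmetrical code that satisfies node regeneration, and for any j₁ ∈ [1:d−1], i ∈ [0:j₁], i' ∈ [max{0, i−1} : i], and j₂ ∈ [i' : j₁−1], one has (T_{d,j₁,j₂}/(d−j₁)) · H(U^{(i,j₁)} | M^{(j₁)}) + H(U^{(i',j₁)} | M^{(j₁)}) ≥ (T_{d,j₁,j₂}/(d−j₁)) · H(U^{(i,j₁+1)} | M^{(j₁)}) + H(U^{(i',j₂)} | M^{(j₁)}). -/

import Mathlib

open scoped BigOperators Classical

namespace MDCSR

noncomputable section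

/-- `X` is a deterministic function of `Y`. -/
def IsFuncOf {Ω α β : Type*} (X : Ω → α) (Y : Ω → β) : Prop :=
  ∃ f : β → α, ∀ ω, X ω = f (Y ω)

variable {Ω V : Type} [Fintype Ω]

/-- Probability of the event `X = x` under the probability mass function `p`. -/
def pm (p : Ω → ℝ) {α : Type*} (X : Ω → α) (x : α) : ℝ :=
  ∑ ω ∈ Finset.univ.filter (fun ω' => X ω' = x), p ω

/-- Shannon entropy of the random variable `X` under the probability mass function `p`. -/
def H (p : Ω → ℝ) {α : Type*} (X : Ω → α) : ℝ :=
  -∑ ω, p ω * Real.log (pm p X (X ω))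

/-- An `(n = d+1, d)` code: messages `M 1, …, M d`, a key `K`, node contents
`W 1, …, W (d+1)`, and repair data `S i j` (data downloaded from node `i` to repair
node `j`), all random variables on a common finite probability space `(Ω, p)`.
The messages are mutually independent, the key is independent of the messages,
each `W i` is a deterministic function of the messages and the key, and each
`S i j` is a deterministic function of `W i`. -/
structure Code (Ω V : Type) [Fintype Ω] (d : ℕ) : Type where
  p : Ω → ℝ
  p_nonneg : ∀ ω, 0 ≤ p ω
  p_sum : ∑ ω, p ω = 1
  M : ℕ → Ω → V
  K : Ω → V
  W : ℕ → Ω → V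
  S : ℕ → ℕ → Ω → V
  M_indep : ∀ x : ℕ → V,
    pm p (fun ω (i : Fin d) => M (↑i + 1) ω) (fun i => x (↑i + 1)) =
      ∏ i ∈ Finset.Icc 1 d, pm p (M i) (x i)
  K_indep : ∀ (k : V) (x : ℕ → V),
    pm p (fun ω => (K ω, fun (i : Fin d) => M (↑i + 1) ω)) (k, fun i => x (↑i + 1)) =
      pm p K k * pm p (fun ω (i : Fin d) => M (↑i + 1) ω) (fun i => x (↑i + 1))
  W_func : ∀ i ∈ Finset.Icc 1 (d + 1),
    IsFuncOf (W i) (fun ω => ((fun (j : Fin d) => M (↑j + 1) ω), K ω))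
  S_func : ∀ i ∈ Finset.Icc 1 (d + 1), ∀ j ∈ Finset.Icc 1 (d + 1), i ≠ j →
    IsFuncOf (S i j) (W i)

/-- Descriptors for the basic random variables of a code. -/
inductive Atom where
  | M : ℕ → Atom
  | K : Atom
  | W : ℕ → Atom
  | S : ℕ → ℕ → Atom

variable {d : ℕ}

/-- The random variable described by an atom. -/
def Code.atomRV (C : Code Ω V d) : Atom → Ω → V
  | .M i => C.M i
  | .K => C.K
  | .W i => C.W i
  | .S i j => C.S i j

/-- The joint random variable (tuple) described by a list of atoms. -/
def Code.rv (C : Code Ω V d) (L : List Atom) : Ω → List V :=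
  fun ω => L.map fun a => C.atomRV a ω

/-- Joint entropy of a tuple of basic random variables. -/
def Code.HL (C : Code Ω V d) (L : List Atom) : ℝ := H C.p (C.rv L)

/-- Conditional entropy `H(L₁ | L₂)`. -/
def Code.CH (C : Code Ω V d) (L₁ L₂ : List Atom) : ℝ := C.HL (L₁ ++ L₂) - C.HL L₂

/-- Mutual information `I(L₁ ; L₂)`. -/
def Code.MI (C : Code Ω V d) (L₁ L₂ : List Atom) : ℝ :=
  C.HL L₁ + C.HL L₂ - C.HL (L₁ ++ L₂)

/-- Relabeling of an atom along a permutation of the storage-node indices. -/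
def Atom.perm (π : Equiv.Perm ℕ) : Atom → Atom
  | .M i => .M i
  | .K => .K
  | .W i => .W (π i)
  | .S i j => .S (π i) (π j)

/-- A code is symmetrical if every joint entropy of a tuple of the basic random
variables is invariant under every permutation of the storage-node indices `[1:n]`. -/
def Code.Symmetrical (C : Code Ω V d) : Prop :=
  ∀ π : Equiv.Perm ℕ, (∀ i ∈ Finset.Icc 1 (d + 1), π i ∈ Finset.Icc 1 (d + 1)) →
    ∀ L : List Atom, C.HL (L.map (Atom.perm π)) = C.HL L

/-- The list `[a, a+1, …, b]`. -/
def icc (a b : ℕ) : List ℕ := List.range' a (b + 1 - a)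

/-- `W_A` as a list of atoms. -/
def Ws (A : List ℕ) : List Atom := A.map Atom.W

/-- `M_A` as a list of atoms. -/
def MsL (A : List ℕ) : List Atom := A.map Atom.M

/-- `M^{(m)} = (M_1, …, M_m)`. -/
def Mup (m : ℕ) : List Atom := MsL (icc 1 m)

/-- `S_{B → j}`. -/
def Sto (B : List ℕ) (j : ℕ) : List Atom := B.map fun i => Atom.S i j

/-- `S_{i → B}`. -/
def Sfrom (i : ℕ) (B : List ℕ) : List Atom := B.map fun j => Atom.S i j

/-- `S̄_{→ j} = S_{[j+1:n] → j}` (here `n = d+1`). -/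
def SbarTo (d j : ℕ) : List Atom := Sto (icc (j + 1) (d + 1)) j

/-- `S̄_{→ A}`. -/
def SbarToL (d : ℕ) (A : List ℕ) : List Atom := (A.map (SbarTo d)).flatten

/-- `S̲_{→ j} = S_{[1:j-1] → j}`. -/
def SunderTo (j : ℕ) : List Atom := Sto (icc 1 (j - 1)) j

/-- `S̲_{→ A}`. -/
def SunderToL (A : List ℕ) : List Atom := (A.map SunderTo).flatten

/-- `S_{→ j} = S_{([1:n] ∖ {j}) → j}` (here `n = d+1`). -/
def StoFull (d j : ℕ) : List Atom := Sto ((icc 1 (d + 1)).filter (fun i => i ≠ j)) j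

/-- `(S_{→ j} : j ∈ A)`. -/
def StoFullL (d : ℕ) (A : List ℕ) : List Atom := (A.map (StoFull d)).flatten

/-- `U^{(t,s)} = (W_{[1:t]}, S̄_{→[t+1:s]})`. -/
def U (d t s : ℕ) : List Atom := Ws (icc 1 t) ++ SbarToL d (icc (t + 1) s)

/-- Node regeneration: each `W j` is a deterministic function of `S_{→ j}`. -/
def Code.NodeRegen (C : Code Ω V d) : Prop :=
  ∀ j ∈ Finset.Icc 1 (d + 1), IsFuncOf (C.W j) (C.rv (StoFull d j))

/-- Message recovery for parameter `ℓ`: `M j` is constant for `j ∈ [1:ℓ]`, and for every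
`A ⊆ [1:n]` with `|A| ∈ [ℓ+1:d]`, `M_{|A|}` is a deterministic function of `W_A`. -/
def Code.MsgRecovery (C : Code Ω V d) (ℓ : ℕ) : Prop :=
  (∀ j ∈ Finset.Icc 1 ℓ, ∃ c : V, ∀ ω, C.M j ω = c) ∧
  ∀ A : Finset ℕ, A ⊆ Finset.Icc 1 (d + 1) → A.card ∈ Finset.Icc (ℓ + 1) d →
    IsFuncOf (C.M A.card) (C.rv (Ws (A.sort (· ≤ ·))))

/-- Repair secrecy for parameters `ℓ₁, ℓ₂`: for all disjoint `E₁, E₂ ⊆ [1:n]` with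
`|E₁| = ℓ₁`, `|E₂| = ℓ₂`, the messages `M_{ℓ+1}, …, M_d` are independent of
`((W_i : i ∈ E₁), (S_{→j} : j ∈ E₂))`, where `ℓ = ℓ₁ + ℓ₂`. -/
def Code.RepairSecrecy (C : Code Ω V d) (ℓ₁ ℓ₂ : ℕ) : Prop :=
  ∀ E₁ E₂ : Finset ℕ, E₁ ⊆ Finset.Icc 1 (d + 1) → E₂ ⊆ Finset.Icc 1 (d + 1) →
    Disjoint E₁ E₂ → E₁.card = ℓ₁ → E₂.card = ℓ₂ →
    C.MI (MsL (icc (ℓ₁ + ℓ₂ + 1) d))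
      (Ws (E₁.sort (· ≤ ·)) ++ StoFullL d (E₂.sort (· ≤ ·))) = 0

/-- `T_{d,k,ℓ} = Σ_{t=ℓ+1}^{k} (d+1−t)`, as a real number. -/
def T (d k ℓ : ℕ) : ℝ := ∑ t ∈ Finset.Icc (ℓ + 1) k, ((d : ℝ) + 1 - (t : ℝ))

lemma H_congr (p : Ω → ℝ) {α β : Type*} {X : Ω → α} {Y : Ω → β}
    (h : ∀ ω ω', X ω = X ω' ↔ Y ω = Y ω') : H p X = H p Y := by
  simp only [H, pm, h]

lemma pm_eq_sum_ite (p : Ω → ℝ) {α : Type*} (X : Ω → α) (x : α) :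
    pm p X x = ∑ ω, if X ω = x then p ω else 0 := by
  rw [pm, Finset.sum_filter]

lemma pm_nonneg {p : Ω → ℝ} (hp : ∀ ω, 0 ≤ p ω) {α : Type*} (X : Ω → α) (x : α) :
    0 ≤ pm p X x :=
  Finset.sum_nonneg fun ω _ => hp ω

lemma le_pm {p : Ω → ℝ} (hp : ∀ ω, 0 ≤ p ω) {α : Type*} (X : Ω → α) (ω : Ω) :
    p ω ≤ pm p X (X ω) :=
  Finset.single_le_sum (f := p) (fun ω _ => hp ω) (by simp)

/-- The quotient `p / P(X)` summed over a single fibre of `X` is at most one. -/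
lemma sum_fibre_div_le_one (p : Ω → ℝ) {α : Type*} (X : Ω → α) (x : α) :
    ∑ ω, (if X ω = x then p ω / pm p X (X ω) else 0) ≤ 1 := by
  have : ∑ ω, (if X ω = x then p ω / pm p X (X ω) else 0) = pm p X x / pm p X x := by
    rw [pm_eq_sum_ite p X x, Finset.sum_div, ← pm_eq_sum_ite p X x]
    refine Finset.sum_congr rfl fun ω _ => ?_
    split_ifs with h <;> simp [h]
  rw [this]
  exact div_self_le_one _

lemma sum_ratio_le_one {p : Ω → ℝ} (hp : ∀ ω, 0 ≤ p ω) (hp1 : ∑ ω, p ω = 1)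
    {α β γ : Type*} (X : Ω → α) (Y : Ω → β) (Z : Ω → γ) :
    ∑ ω, p ω / pm p (fun ω => (X ω, Y ω, Z ω)) (X ω, Y ω, Z ω) *
      (pm p (fun ω => (X ω, Z ω)) (X ω, Z ω) * pm p (fun ω => (Y ω, Z ω)) (Y ω, Z ω)
        / pm p Z (Z ω)) ≤ 1 := by
  set P := pm p (fun ω => (X ω, Y ω, Z ω)) with hP
  have expand : ∀ ω, p ω / P (X ω, Y ω, Z ω) *
      (pm p (fun ω => (X ω, Z ω)) (X ω, Z ω) * pm p (fun ω => (Y ω, Z ω)) (Y ω, Z ω)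
        / pm p Z (Z ω)) =
      ∑ b, ∑ a, p b * (if Z a = Z b then p a / pm p Z (Z a) else 0) *
        (if (X ω, Y ω, Z ω) = (X a, Y b, Z b) then p ω / P (X ω, Y ω, Z ω) else 0) := by
    intro ω
    rw [pm_eq_sum_ite p (fun ω => (X ω, Z ω)), pm_eq_sum_ite p (fun ω => (Y ω, Z ω)),
      mul_comm (∑ _, _), Finset.sum_mul_sum, Finset.sum_div, Finset.mul_sum]
    refine Finset.sum_congr rfl fun b _ => ?_
    rw [Finset.sum_div, Finset.mul_sum]
    refine Finset.sum_congr rfl fun a _ => ?_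
    simp only [Prod.mk.injEq]
    by_cases h1 : X a = X ω <;> by_cases h2 : Y b = Y ω <;> by_cases h3 : Z b = Z ω <;>
      by_cases h4 : Z a = Z ω <;> simp [h1, h2, h3, h4, eq_comm]
    · ring
    all_goals grind
  simp_rw [expand]
  rw [Finset.sum_comm]
  calc _ ≤ ∑ b, p b * 1 := ?_
    _ = 1 := by simpa using hp1
  refine Finset.sum_le_sum fun b _ => ?_
  rw [Finset.sum_comm]
  simp_rw [← Finset.mul_sum, mul_assoc]
  rw [← Finset.mul_sum]
  refine mul_le_mul_of_nonneg_left ?_ (hp b)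
  refine le_trans (Finset.sum_le_sum fun a _ => ?_) (sum_fibre_div_le_one p Z (Z b))
  refine mul_le_of_le_one_right ?_ ?_
  · split_ifs
    · exact div_nonneg (hp a) (pm_nonneg hp _ _)
    · exact le_rfl
  · refine le_of_eq_of_le (Finset.sum_congr rfl fun ω _ => ?_)
      (sum_fibre_div_le_one p (fun ω => (X ω, Y ω, Z ω)) (X a, Y b, Z b))
    congr

/-- Submodularity of Shannon entropy. -/
lemma H_submodular {p : Ω → ℝ} (hp : ∀ ω, 0 ≤ p ω) (hp1 : ∑ ω, p ω = 1)
    {α β γ : Type*} (X : Ω → α) (Y : Ω → β) (Z : Ω → γ) :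
    H p (fun ω => (X ω, Y ω, Z ω)) + H p Z ≤
      H p (fun ω => (X ω, Z ω)) + H p (fun ω => (Y ω, Z ω)) := by
  have key : ∀ ω, p ω * Real.log (pm p (fun ω => (X ω, Z ω)) (X ω, Z ω)) +
      p ω * Real.log (pm p (fun ω => (Y ω, Z ω)) (Y ω, Z ω)) -
      p ω * Real.log (pm p (fun ω => (X ω, Y ω, Z ω)) (X ω, Y ω, Z ω)) -
      p ω * Real.log (pm p Z (Z ω)) ≤
      p ω / pm p (fun ω => (X ω, Y ω, Z ω)) (X ω, Y ω, Z ω) *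
      (pm p (fun ω => (X ω, Z ω)) (X ω, Z ω) * pm p (fun ω => (Y ω, Z ω)) (Y ω, Z ω)
        / pm p Z (Z ω)) - p ω := by
    intro ω
    rcases (hp ω).eq_or_lt with h0 | hpos
    · simp [← h0]
    have h1 := hpos.trans_le (le_pm hp (fun ω => (X ω, Z ω)) ω)
    have h2 := hpos.trans_le (le_pm hp (fun ω => (Y ω, Z ω)) ω)
    have h3 := hpos.trans_le (le_pm hp (fun ω => (X ω, Y ω, Z ω)) ω)
    have h4 := hpos.trans_le (le_pm hp Z ω)
    generalize pm p (fun ω => (X ω, Z ω)) (X ω, Z ω) = a at *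
    generalize pm p (fun ω => (Y ω, Z ω)) (Y ω, Z ω) = b at *
    generalize pm p (fun ω => (X ω, Y ω, Z ω)) (X ω, Y ω, Z ω) = c at *
    generalize pm p Z (Z ω) = e at *
    have hlog := Real.log_le_sub_one_of_pos (show 0 < a * b / (c * e) by positivity)
    rw [Real.log_div (by positivity) (by positivity), Real.log_mul h1.ne' h2.ne',
      Real.log_mul h3.ne' h4.ne'] at hlog
    have hmul := mul_le_mul_of_nonneg_left hlog hpos.le
    have : p ω * (a * b / (c * e) - 1) = p ω / c * (a * b / e) - p ω := by
      field_simp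
    linarith
  have hsum := Finset.sum_le_sum fun ω (_ : ω ∈ Finset.univ) => key ω
  simp only [Finset.sum_sub_distrib, Finset.sum_add_distrib, hp1] at hsum
  have := sum_ratio_le_one hp hp1 X Y Z
  simp only [H]
  linarith

/-- Joint entropy of a set of basic random variables. -/
def Code.setH (C : Code Ω V d) (s : Set Atom) : ℝ :=
  H C.p fun ω (a : s) => C.atomRV a ω

/-- The atom `a` is determined by the atoms in `s`. -/
def Code.Determines (C : Code Ω V d) (s : Set Atom) (a : Atom) : Prop :=
  ∀ ω ω', (∀ b ∈ s, C.atomRV b ω = C.atomRV b ω') → C.atomRV a ω = C.atomRV a ω'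

lemma Code.HL_eq_setH (C : Code Ω V d) (L : List Atom) : C.HL L = C.setH {a | a ∈ L} := by
  refine H_congr _ fun ω ω' => ?_
  simp [Code.rv, funext_iff]

lemma Code.setH_submodular (C : Code Ω V d) (A B Z : Set Atom) :
    C.setH (A ∪ B ∪ Z) + C.setH Z ≤ C.setH (A ∪ Z) + C.setH (B ∪ Z) := by
  have h := H_submodular C.p_nonneg C.p_sum (fun ω (a : A) => C.atomRV a ω)
    (fun ω (a : B) => C.atomRV a ω) (fun ω (a : Z) => C.atomRV a ω)
  have e1 : C.setH (A ∪ B ∪ Z) = _ := H_congr C.p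
    (Y := fun ω => ((fun a : A => C.atomRV a ω), (fun a : B => C.atomRV a ω),
      (fun a : Z => C.atomRV a ω))) fun ω ω' => by
    simp [funext_iff, or_imp, forall_and, and_assoc]
  have e2 (A : Set Atom) : C.setH (A ∪ Z) = _ := H_congr C.p
    (Y := fun ω => ((fun a : A => C.atomRV a ω), (fun a : Z => C.atomRV a ω))) fun ω ω' => by
    simp [funext_iff, or_imp, forall_and]
  rw [e1, e2, e2]
  exact h

lemma Code.setH_union_of_determines (C : Code Ω V d) {s t : Set Atom}
    (h : ∀ a ∈ t, C.Determines s a) : C.setH (s ∪ t) = C.setH s := by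
  refine H_congr _ fun ω ω' => ?_
  simp only [funext_iff, Subtype.forall]
  exact ⟨fun h' a ha => h' a (Or.inl ha), fun h' a ha => ha.elim (h' a) fun ha => h a ha ω ω' h'⟩

lemma Code.Symmetrical.setH_image {C : Code Ω V d} (hsym : C.Symmetrical) (π : Equiv.Perm ℕ)
    (hπ : ∀ i ∈ Finset.Icc 1 (d + 1), π i ∈ Finset.Icc 1 (d + 1)) {s : Set Atom}
    (hs : s.Finite) : C.setH (Atom.perm π '' s) = C.setH s := by
  have h := hsym π hπ hs.toFinset.toList
  rw [C.HL_eq_setH, C.HL_eq_setH] at h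
  convert h using 2
  · ext a
    simp
  · ext a
    simp

lemma Code.determines_of_mem (C : Code Ω V d) {s : Set Atom} {a : Atom} (h : a ∈ s) :
    C.Determines s a :=
  fun _ _ h' => h' a h

lemma Code.Determines.of_isFuncOf {C : Code Ω V d} {s : Set Atom} {a : Atom} {L : List Atom}
    (h : IsFuncOf (C.atomRV a) (C.rv L)) (hL : ∀ b ∈ L, C.Determines s b) :
    C.Determines s a := by
  obtain ⟨f, hf⟩ := h
  intro ω ω' hω
  rw [hf, hf]
  congr 1
  exact List.map_congr_left fun b hb => hL b hb ω ω' hω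

lemma Code.Determines.repair {C : Code Ω V d} {s : Set Atom} {a b : ℕ}
    (ha : a ∈ Finset.Icc 1 (d + 1)) (hb : b ∈ Finset.Icc 1 (d + 1)) (hab : a ≠ b)
    (h : C.Determines s (.W a)) : C.Determines s (.S a b) := by
  obtain ⟨f, hf⟩ := C.S_func a ha b hb hab
  intro ω ω' hω
  simp only [Code.atomRV, hf]
  exact congrArg f (h ω ω' hω)

/-- Atoms of `U^{(t,s)}` together with those of `M^{(m)}`. -/
def condU (d m t s : ℕ) : Set Atom := {a | a ∈ U d t s ++ Mup m}

lemma mem_icc {a b x : ℕ} : x ∈ icc a b ↔ a ≤ x ∧ x ≤ b := by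
  simp only [icc, List.mem_range'_1]
  omega

lemma finite_condU (d m t s : ℕ) : (condU d m t s).Finite := List.finite_toSet _

lemma mem_condU {m t s : ℕ} {a : Atom} : a ∈ condU d m t s ↔
    (∃ k, 1 ≤ k ∧ k ≤ t ∧ a = .W k) ∨
    (∃ b c, t + 1 ≤ b ∧ b ≤ s ∧ b + 1 ≤ c ∧ c ≤ d + 1 ∧ a = .S c b) ∨
    ∃ k, 1 ≤ k ∧ k ≤ m ∧ a = .M k := by
  simp [condU, U, Mup, Ws, MsL, SbarToL, SbarTo, Sto, mem_icc, and_assoc, eq_comm]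

/-- By successive node regeneration, `U^{(t,s)}` determines the first `s` nodes. -/
lemma Code.NodeRegen.determines_W {C : Code Ω V d} (hregen : C.NodeRegen) {m t s : ℕ}
    (hs : s ≤ d + 1) {k : ℕ} (hk1 : 1 ≤ k) (hks : k ≤ s) :
    C.Determines (condU d m t s) (.W k) := by
  induction k using Nat.strong_induction_on with
  | _ k ih =>
    by_cases hkt : k ≤ t
    · exact C.determines_of_mem (mem_condU.2 (Or.inl ⟨k, hk1, hkt, rfl⟩))
    refine .of_isFuncOf (hregen k (by simp; omega)) fun b hb => ?_
    simp only [StoFull, Sto, List.mem_map, List.mem_filter, mem_icc, decide_eq_true_eq] at hb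
    obtain ⟨a, ⟨ha, hak⟩, rfl⟩ := hb
    rcases lt_or_gt_of_ne hak with h | h
    · exact .repair (by simp; omega) (by simp; omega) hak (ih a h ha.1 (by omega))
    · exact C.determines_of_mem
        (mem_condU.2 (Or.inr (Or.inl ⟨k, a, by omega, hks, h, ha.2, rfl⟩)))

lemma concave_chord {f : ℕ → ℝ} {N q : ℕ} (hq : q ≤ N)
    (hf : ∀ k, k + 2 ≤ N → f (k + 2) + f k ≤ 2 * f (k + 1)) :
    (q : ℝ) * (f N - f 0) ≤ N * (f q - f 0) := by
  have tangent : ∀ k, k + 1 ≤ N → (k : ℝ) * (f (k + 1) - f k) ≤ f k - f 0 := by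
    intro k
    induction k with
    | zero => simp
    | succ k ih =>
      intro hk
      have h1 := ih (by omega)
      have h2 := hf k hk
      push_cast
      nlinarith [mul_le_mul_of_nonneg_left h2 (show (0 : ℝ) ≤ k + 1 by positivity)]
  have chord : ∀ n, q ≤ n → n ≤ N → (q : ℝ) * (f n - f 0) ≤ n * (f q - f 0) := by
    intro n hn
    induction n, hn using Nat.le_induction with
    | base => simp
    | succ n hn ih =>
      intro hnN
      rcases Nat.eq_zero_or_pos n with rfl | hpos
      · obtain rfl : q = 0 := by omega
        simp
      have h1 := ih (by omega)
      have h2 := tangent n hnN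
      have hn0 : (0 : ℝ) < n := by exact_mod_cast hpos
      refine le_of_mul_le_mul_left ?_ hn0
      push_cast
      nlinarith [mul_le_mul_of_nonneg_left h1 (show (0 : ℝ) ≤ n + 1 by positivity),
        mul_le_mul_of_nonneg_left h2 (show (0 : ℝ) ≤ q by positivity)]
  exact chord N hq le_rfl

/-- The permutation sending `j` to `m + 1` and `[j+1 : m+1]` into `[1 : m]`, which shifts
`[s : j-1]` up by one and fixes everything outside `[s : m+1]`. -/
def shiftPerm (s j m : ℕ) (hs : s ≤ j) (hj : j ≤ m) : Equiv.Perm ℕ where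
  toFun k := if k < s then k else if k < j then k + 1 else if k = j then m + 1
    else if k = j + 1 then s else if k ≤ m + 1 then k - 1 else k
  invFun k := if k < s then k else if k = s then j + 1 else if k ≤ j then k - 1
    else if k ≤ m then k + 1 else if k = m + 1 then j else k
  left_inv k := by grind
  right_inv k := by grind

/-- Repair data sent to node `t` by the nodes in `[a : b]`. -/
def repairTo (a b t : ℕ) : Set Atom := {x | ∃ k, a ≤ k ∧ k ≤ b ∧ x = .S k t}

lemma finite_repairTo (a b t : ℕ) : (repairTo a b t).Finite :=
  ((Set.finite_Icc a b).image fun k => Atom.S k t).subset <| by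
    rintro _ ⟨k, h1, h2, rfl⟩
    exact ⟨k, ⟨h1, h2⟩, rfl⟩

lemma condU_succ {m t s : ℕ} (h : t ≤ s) :
    condU d m t (s + 1) = condU d m t s ∪ repairTo (s + 2) (d + 1) (s + 1) := by
  ext a
  simp only [Set.mem_union, mem_condU, repairTo, Set.mem_ofPred_eq]
  constructor
  · rintro (h1 | ⟨b, c, h1, h2, h3, h4, rfl⟩ | h1)
    · exact Or.inl (Or.inl h1)
    · rcases h2.lt_or_eq with h5 | rfl
      · exact Or.inl (Or.inr (Or.inl ⟨b, c, h1, by omega, h3, h4, rfl⟩))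
      · exact Or.inr ⟨c, h3, h4, rfl⟩
    · exact Or.inl (Or.inr (Or.inr h1))
  · rintro ((h1 | ⟨b, c, h1, h2, h3, h4, rfl⟩ | h1) | ⟨c, h1, h2, rfl⟩)
    · exact Or.inl h1
    · exact Or.inr (Or.inl ⟨b, c, h1, by omega, h3, h4, rfl⟩)
    · exact Or.inr (Or.inr h1)
    · exact Or.inr (Or.inl ⟨s + 1, c, by omega, le_rfl, h1, h2, rfl⟩)

/-- Concavity in `k` of `H(U^{(t,s)}, S_{[s+2 : s+1+k] → s+1}, M^{(m)})`. -/
lemma Code.Symmetrical.concave_repairTo {C : Code Ω V d} (hsym : C.Symmetrical) {m t s k : ℕ}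
    (hts : t ≤ s) (hk : s + 1 + (k + 2) ≤ d + 1) :
    C.setH (condU d m t s ∪ repairTo (s + 2) (s + 1 + (k + 2)) (s + 1)) +
      C.setH (condU d m t s ∪ repairTo (s + 2) (s + 1 + k) (s + 1)) ≤
      2 * C.setH (condU d m t s ∪ repairTo (s + 2) (s + 1 + (k + 1)) (s + 1)) := by
  set Z := condU d m t s ∪ repairTo (s + 2) (s + 1 + k) (s + 1) with hZ
  set a := s + 1 + (k + 1) with ha
  have e1 : condU d m t s ∪ repairTo (s + 2) a (s + 1) = {Atom.S a (s + 1)} ∪ Z := by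
    ext x
    simp only [hZ, repairTo, Set.mem_union, Set.mem_ofPred_eq, Set.mem_singleton_iff]
    grind
  have e2 : condU d m t s ∪ repairTo (s + 2) (s + 1 + (k + 2)) (s + 1) =
      {Atom.S a (s + 1)} ∪ {Atom.S (a + 1) (s + 1)} ∪ Z := by
    ext x
    simp only [hZ, repairTo, Set.mem_union, Set.mem_ofPred_eq, Set.mem_singleton_iff]
    grind
  have hfin : ({Atom.S a (s + 1)} ∪ Z : Set Atom).Finite :=
    (Set.finite_singleton _).union ((finite_condU _ _ _ _).union (finite_repairTo _ _ _))
  have hswap : ∀ x ∈ Z, Atom.perm (Equiv.swap a (a + 1)) x ∈ Z := by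
    rintro x (hx | ⟨c, h1, h2, rfl⟩)
    · refine Or.inl ?_
      rw [mem_condU] at hx ⊢
      rcases hx with ⟨c, h1, h2, rfl⟩ | ⟨b, c, h1, h2, h3, h4, rfl⟩ | ⟨c, h1, h2, rfl⟩
      · refine Or.inl ⟨c, h1, h2, ?_⟩
        rw [Atom.perm, Equiv.swap_apply_of_ne_of_ne (by omega) (by omega)]
      · refine Or.inr (Or.inl ⟨b, Equiv.swap a (a + 1) c, h1, h2, ?_, ?_, ?_⟩)
        · rw [Equiv.swap_apply_def]; split_ifs <;> omega
        · rw [Equiv.swap_apply_def]; split_ifs <;> omega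
        · rw [Atom.perm, Equiv.swap_apply_of_ne_of_ne (x := b) (by omega) (by omega)]
      · exact Or.inr (Or.inr ⟨c, h1, h2, rfl⟩)
    · refine Or.inr ⟨c, h1, h2, ?_⟩
      rw [Atom.perm, Equiv.swap_apply_of_ne_of_ne (by omega) (by omega),
        Equiv.swap_apply_of_ne_of_ne (by omega) (by omega)]
  have hinv : ∀ x, Atom.perm (Equiv.swap a (a + 1)) (Atom.perm (Equiv.swap a (a + 1)) x) = x := by
    rintro (_ | _ | _ | _) <;> simp [Atom.perm]
  have himage : Atom.perm (Equiv.swap a (a + 1)) '' Z = Z :=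
    Set.Subset.antisymm (Set.image_subset_iff.2 hswap)
      fun x hx => ⟨_, hswap x hx, hinv x⟩
  have e3 := hsym.setH_image (Equiv.swap a (a + 1)) (fun i hi => by
    simp only [Finset.mem_Icc] at hi ⊢
    rw [Equiv.swap_apply_def]
    split_ifs <;> omega) hfin
  rw [Set.image_union, Set.image_singleton, himage, Atom.perm, Equiv.swap_apply_left,
    Equiv.swap_apply_of_ne_of_ne (by omega) (by omega)] at e3
  have := C.setH_submodular {Atom.S a (s + 1)} {Atom.S (a + 1) (s + 1)} Z
  rw [e1, e2]
  linarith

/-- One step of the exchange inequality. -/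
lemma Code.Symmetrical.exchange {C : Code Ω V d} (hsym : C.Symmetrical) (hregen : C.NodeRegen)
    {m i i' s : ℕ} (hm : m + 1 ≤ d) (hi : i ≤ m) (hi1 : i ≤ i' + 1) (hi2 : i' ≤ i)
    (hs : i' ≤ s) (hsm : s + 1 ≤ m) :
    ((d : ℝ) - s) * (C.setH (condU d m i (m + 1)) - C.setH (condU d m i m)) ≤
      ((d : ℝ) - m) * (C.setH (condU d m i' (s + 1)) - C.setH (condU d m i' s)) := by
  set Y := condU d m i' s with hY
  have hchord := concave_chord (q := m - s) (N := d - s) (by omega)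
    (f := fun k => C.setH (Y ∪ repairTo (s + 2) (s + 1 + k) (s + 1)))
    fun k hk => hsym.concave_repairTo hs (by omega)
  obtain ⟨r, hr, hr0, hrY⟩ : ∃ r, ∃ hr : r ≤ s + 1, 1 ≤ r ∧
      ∀ x ∈ Y, C.Determines (condU d m i m) (Atom.perm (shiftPerm r (s + 1) m hr hsm) x) := by
    refine ⟨if i' = i then s + 1 else i, by split_ifs <;> omega, by split_ifs <;> omega,
      fun x hx => ?_⟩
    rcases mem_condU.1 hx with ⟨c, h1, h2, rfl⟩ | ⟨b, c, h1, h2, h3, h4, rfl⟩ | ⟨c, h1, h2, rfl⟩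
    · exact hregen.determines_W (by omega) (by simp [shiftPerm]; grind)
        (by simp [shiftPerm]; grind)
    · rw [Atom.perm]
      set π := shiftPerm (if i' = i then s + 1 else i) (s + 1) m (by split_ifs <;> omega) hsm
        with hπ
      have hb : i + 1 ≤ π b ∧ π b ≤ m := by simp [hπ, shiftPerm]; grind
      have hc : 1 ≤ π c ∧ π c ≤ d + 1 ∧ (π b + 1 ≤ π c ∨ π c = i) := by
        simp [hπ, shiftPerm]; grind
      rcases hc.2.2 with h | h
      · exact C.determines_of_mem
          (mem_condU.2 (Or.inr (Or.inl ⟨π b, π c, hb.1, hb.2, h, hc.2.1, rfl⟩)))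
      · exact .repair (by simp; omega) (by simp; omega) (by omega)
          (hregen.determines_W (by omega) hc.1 (by omega))
    · exact C.determines_of_mem (mem_condU.2 (Or.inr (Or.inr ⟨c, h1, h2, rfl⟩)))
  set σ := shiftPerm r (s + 1) m hr hsm with hσ
  have hσj : σ (s + 1) = m + 1 := by simp [hσ, shiftPerm]; grind
  have hσm : ∀ c, s + 2 ≤ c → c ≤ m + 1 → 1 ≤ σ c ∧ σ c ≤ m := fun c h1 h2 => by
    simp [hσ, shiftPerm]; grind
  have hσfix : ∀ c, m + 2 ≤ c → σ c = c := fun c h => by simp [hσ, shiftPerm]; grind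
  have hσn : ∀ c ∈ Finset.Icc 1 (d + 1), σ c ∈ Finset.Icc 1 (d + 1) := fun c hc => by
    simp only [Finset.mem_Icc] at hc ⊢
    simp [hσ, shiftPerm]; grind
  set R := repairTo (s + 2) (m + 1) (s + 1) with hR
  set Z := Atom.perm σ '' (Y ∪ R) with hZ
  have hZdet : ∀ x ∈ Z, C.Determines (condU d m i m) x := by
    rintro _ ⟨x, hx | ⟨c, h1, h2, rfl⟩, rfl⟩
    · exact hrY x hx
    · obtain ⟨h3, h4⟩ := hσm c h1 h2
      rw [Atom.perm, hσj]
      exact .repair (by simp; omega) (by simp; omega) (by omega)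
        (hregen.determines_W (by omega) h3 h4)
  set A := repairTo (m + 2) (d + 1) (m + 1) with hA
  have hAimage : Atom.perm σ '' repairTo (m + 2) (d + 1) (s + 1) = A := by
    ext x
    constructor
    · rintro ⟨_, ⟨c, h1, h2, rfl⟩, rfl⟩
      exact ⟨c, h1, h2, by rw [Atom.perm, hσj, hσfix c h1]⟩
    · rintro ⟨c, h1, h2, rfl⟩
      exact ⟨_, ⟨c, h1, h2, rfl⟩, by rw [Atom.perm, hσj, hσfix c h1]⟩
  have hsplit : condU d m i' (s + 1) = repairTo (m + 2) (d + 1) (s + 1) ∪ (Y ∪ R) := by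
    rw [condU_succ hs]
    ext x
    simp only [hR, hY, repairTo, Set.mem_union, Set.mem_ofPred_eq]
    grind
  have hN : C.setH (condU d m i' (s + 1)) = C.setH (A ∪ Z) := by
    rw [← hsym.setH_image σ hσn (finite_condU _ _ _ _), hsplit, Set.image_union, hAimage]
  have hq : C.setH (Y ∪ R) = C.setH Z :=
    (hsym.setH_image σ hσn ((finite_condU _ _ _ _).union (finite_repairTo _ _ _))).symm
  have hU : C.setH (condU d m i m ∪ Z) = C.setH (condU d m i m) :=
    C.setH_union_of_determines hZdet
  have hUA : C.setH (A ∪ condU d m i m ∪ Z) = C.setH (condU d m i (m + 1)) := by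
    rw [condU_succ hi, Set.union_comm A]
    exact C.setH_union_of_determines fun x hx ω ω' h =>
      hZdet x hx ω ω' fun b hb => h b (Or.inl hb)
  have hsub := C.setH_submodular A (condU d m i m) Z
  have h0 : Y ∪ repairTo (s + 2) (s + 1 + 0) (s + 1) = Y := by
    ext x
    simp only [repairTo, Set.mem_union, Set.mem_ofPred_eq]
    grind
  have h1 : s + 1 + (d - s) = d + 1 := by omega
  have h2 : s + 1 + (m - s) = m + 1 := by omega
  rw [h0, h1, h2, ← hR, ← condU_succ hs, Nat.cast_sub (by omega), Nat.cast_sub (by omega)]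
    at hchord
  have hds : (0 : ℝ) ≤ (d : ℝ) - s := by
    rw [sub_nonneg]
    exact_mod_cast (by omega : s ≤ d)
  have hstep : C.setH (condU d m i (m + 1)) - C.setH (condU d m i m) ≤
      C.setH (condU d m i' (s + 1)) - C.setH (Y ∪ R) := by
    linarith
  nlinarith [mul_le_mul_of_nonneg_left hstep hds]

lemma Code.Symmetrical.sum_exchange {C : Code Ω V d} (hsym : C.Symmetrical)
    (hregen : C.NodeRegen) {m i i' ℓ : ℕ} (hm : m + 1 ≤ d) (hi : i ≤ m) (hi1 : i ≤ i' + 1)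
    (hi2 : i' ≤ i) (hℓ : i' ≤ ℓ) (hℓm : ℓ ≤ m) :
    T d m ℓ * (C.setH (condU d m i (m + 1)) - C.setH (condU d m i m)) ≤
      ((d : ℝ) - m) * (C.setH (condU d m i' m) - C.setH (condU d m i' ℓ)) := by
  have h : ∀ s, ℓ ≤ s → s ≤ m →
      T d s ℓ * (C.setH (condU d m i (m + 1)) - C.setH (condU d m i m)) ≤
      ((d : ℝ) - m) * (C.setH (condU d m i' s) - C.setH (condU d m i' ℓ)) := by
    intro s hs
    induction s, hs using Nat.le_induction with
    | base => simp [T]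
    | succ s hs ih =>
      intro hsm
      have h1 := ih (by omega)
      have h2 := hsym.exchange hregen hm hi hi1 hi2 (hℓ.trans hs) hsm
      have h3 : T d (s + 1) ℓ = T d s ℓ + ((d : ℝ) - s) := by
        rw [T, Finset.sum_Icc_succ_top (by omega), T]
        push_cast
        ring
      rw [h3]
      linarith
  exact h m hℓm le_rfl

theorem statement7 {Ω V : Type} [Fintype Ω] {d : ℕ} (hd : 2 ≤ d)
    (C : Code Ω V d) (hsym : C.Symmetrical) (hregen : C.NodeRegen)
    {j₁ i i' j₂ : ℕ} (hj₁ : j₁ ∈ Finset.Icc 1 (d - 1)) (hi : i ∈ Finset.Icc 0 j₁)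
    (hi' : i' ∈ Finset.Icc (i - 1) i) (hj₂ : j₂ ∈ Finset.Icc i' (j₁ - 1)) :
    T d j₁ j₂ / ((d : ℝ) - (j₁ : ℝ)) * C.CH (U d i j₁) (Mup j₁) + C.CH (U d i' j₁) (Mup j₁)
      ≥ T d j₁ j₂ / ((d : ℝ) - (j₁ : ℝ)) * C.CH (U d i (j₁ + 1)) (Mup j₁)
        + C.CH (U d i' j₂) (Mup j₁) := by
  simp only [Finset.mem_Icc] at hj₁ hi hi' hj₂
  have hpos : (0 : ℝ) < (d : ℝ) - j₁ := by
    rw [sub_pos]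
    exact_mod_cast (by omega : j₁ < d)
  have h := hsym.sum_exchange hregen (m := j₁) (i := i) (i' := i') (ℓ := j₂) (by omega) hi.2
    (by omega) hi'.2 hj₂.1 (by omega)
  rw [← div_le_iff₀' hpos, mul_div_right_comm] at h
  simp only [Code.CH, C.HL_eq_setH (U d _ _ ++ _)]
  change T d j₁ j₂ / (d - j₁) * (C.setH (condU d j₁ i j₁) - _) +
      (C.setH (condU d j₁ i' j₁) - _) ≥
    T d j₁ j₂ / (d - j₁) * (C.setH (condU d j₁ i (j₁ + 1)) - _) +
      (C.setH (condU d j₁ i' j₂) - _)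
  linarith

end

end MDCSR
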